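/- Let S, A, B be finite nonempty types, M : S → Matrix A B ℝ, and for p : S → ℝ let V p = inf over y ∈ stdSimplex ℝ B of ∑ s, p s * (max over a of (M s *ᵥ y) a). Let p lie in the nonnegative orthant O = {p : S → ℝ | ∀ s, 0 ≤ p s}, and let y* ∈ stdSimplex ℝ B attain this infimum at p. Define g : S → ℝ by g s = max over a of (M s *ᵥ y*) a. Then ⟪g, p⟫ = V p, and for every q ∈ O one has V q ≤ V p + ⟪g, q − p⟫; that is, g is a supergradient of V at p over O. Consequently, for every state s, g s = V p + ⟪g, e_s − p⟫, where e_s : S → ℝ is the indicator vector of s. -/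

import Mathlib

open scoped BigOperators Matrix

theorem neg_sum_abs_le_mulVec {A B : Type*} [Fintype B] (N : Matrix A B ℝ) (a : A)
    {y : B → ℝ} (hy : y ∈ stdSimplex ℝ B) : -∑ b, |N a b| ≤ (N *ᵥ y) a := by
  rw [Matrix.mulVec, dotProduct, ← Finset.sum_neg_distrib]
  refine Finset.sum_le_sum fun b _ => ?_
  have hy₁ : y b ≤ 1 := hy.2 ▸ Finset.single_le_sum (fun c _ => hy.1 c) (Finset.mem_univ b)
  calc -|N a b| ≤ -|N a b| * y b := by nlinarith [abs_nonneg (N a b)]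
    _ ≤ N a b * y b := mul_le_mul_of_nonneg_right (neg_abs_le _) (hy.1 b)

/-- The payoffs whose infimum defines the belief value are bounded below on the simplex. -/
theorem bddBelow_range_sum_mul_iSup_mulVec {S A B : Type*} [Fintype S] [Fintype A] [Fintype B]
    [Nonempty A] (M : S → Matrix A B ℝ) {q : S → ℝ} (hq : ∀ s, 0 ≤ q s) :
    BddBelow (Set.range fun y : stdSimplex ℝ B =>
      ∑ s, q s * (⨆ a, (M s *ᵥ (y : B → ℝ)) a)) := by
  obtain ⟨a⟩ := ‹Nonempty A›
  refine ⟨∑ s, q s * -∑ b, |M s a b|, ?_⟩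
  rintro _ ⟨y, rfl⟩
  refine Finset.sum_le_sum fun s _ => mul_le_mul_of_nonneg_left ?_ (hq s)
  exact (neg_sum_abs_le_mulVec (M s) a y.2).trans (le_ciSup (Set.finite_range _).bddAbove a)

/-- If `y*` attains the infimum defining the one-shot belief-value
function `V` at `p`, then the vector of best-response values
`g s = max_a (M s *ᵥ y*) a` satisfies `⟪g, p⟫ = V p` and is a supergradient of
`V` at `p` over the nonnegative orthant; consequently
`g s = V p + ⟪g, e_s − p⟫` for every state `s`. -/
theorem infostate_values_supergradient
    {S A B : Type*} [Fintype S] [Fintype A] [Fintype B]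
    [Nonempty S] [Nonempty A] [Nonempty B] [DecidableEq S]
    (M : S → Matrix A B ℝ)
    (V : (S → ℝ) → ℝ)
    (hV : ∀ p : S → ℝ,
      V p = ⨅ y : stdSimplex ℝ B, ∑ s, p s * (⨆ a, (M s *ᵥ (y : B → ℝ)) a))
    (O : Set (S → ℝ)) (hO : O = {p : S → ℝ | ∀ s, 0 ≤ p s})
    (p : S → ℝ) (hp : p ∈ O)
    (ystar : B → ℝ) (hystar : ystar ∈ stdSimplex ℝ B)
    (hopt : ∑ s, p s * (⨆ a, (M s *ᵥ ystar) a) = V p)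
    (g : S → ℝ) (hg : ∀ s, g s = ⨆ a, (M s *ᵥ ystar) a) :
    (∑ s, g s * p s) = V p ∧
    (∀ q ∈ O, V q ≤ V p + ∑ s, g s * (q s - p s)) ∧
    (∀ s : S, g s = V p + ∑ s', g s' * ((if s' = s then (1 : ℝ) else 0) - p s')) := by
  subst hO
  have hgp : ∑ s, g s * p s = V p := by
    simp only [← hopt, hg, mul_comm]
  refine ⟨hgp, fun q hq => ?_, fun s => ?_⟩
  · have hle : V q ≤ ∑ s, q s * g s := by
      simp only [hV q, hg]
      exact ciInf_le (bddBelow_range_sum_mul_iSup_mulVec M hq) ⟨ystar, hystar⟩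
    simpa only [mul_sub, Finset.sum_sub_distrib, hgp, add_sub_cancel, mul_comm (g _) (q _)]
      using hle
  · simp [mul_sub, Finset.sum_sub_distrib, hgp]
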